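/- arXiv:1907.07078 — 2 statements merged into one kernel-verified Lean document; each statement's English description precedes it below -/
import Mathlib

section
/- Let G be a connected finite simple graph and g0 ∈ G an initial node with eccentricity e. Then synchronous flooding from g0 has terminated after round e (that is, R_i = ∅ for all i > e) if and only if G is bipartite. -/
namespace SimpleGraph

variable {V : Type*} {G : SimpleGraph V} {u v w : V} {n : ℕ}

/-- There is a walk of length `n` from `u` to `v`. -/
def HasWalk (G : SimpleGraph V) (u : V) (n : ℕ) (v : V) : Prop :=
  ∃ p : G.Walk u v, p.length = n

/-- `n` is the least length, among those of its parity, of a walk from `u` to `v`. -/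
def HasParityShortestWalk (G : SimpleGraph V) (u : V) (n : ℕ) (v : V) : Prop :=
  G.HasWalk u n v ∧ ∀ m, m + 2 = n → ¬ G.HasWalk u m v

theorem hasWalk_zero : G.HasWalk u 0 v ↔ v = u := by
  constructor
  · rintro ⟨p, hp⟩
    exact (Walk.eq_of_length_eq_zero hp).symm
  · rintro rfl
    exact ⟨.nil, rfl⟩

theorem HasWalk.succ (h : G.HasWalk u n v) (hvw : G.Adj v w) : G.HasWalk u (n + 1) w := by
  obtain ⟨p, rfl⟩ := h
  exact ⟨p.concat hvw, by simp⟩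

theorem HasWalk.exists_adj (h : G.HasWalk u (n + 1) w) :
    ∃ v, G.HasWalk u n v ∧ G.Adj v w := by
  obtain ⟨p, hp⟩ := h
  have hnil : ¬ p.Nil := by
    rw [← Walk.length_eq_zero_iff]
    omega
  exact ⟨p.penultimate, ⟨p.dropLast, by simp [hp]⟩, p.adj_penultimate hnil⟩

theorem HasWalk.add_two_mul (h : G.HasWalk u n v) (hvw : G.Adj v w) (k : ℕ) :
    G.HasWalk u (n + 2 * k) v := by
  induction k with
  | zero => exact h
  | succ k ih => exact (ih.succ hvw).succ hvw.symm

theorem HasWalk.exists_hasParityShortestWalk (h : G.HasWalk u n v) :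
    ∃ m, (Even m ↔ Even n) ∧ G.HasParityShortestWalk u m v := by
  induction n using Nat.strong_induction_on with
  | _ n ih =>
    by_cases hn : ∃ m, m + 2 = n ∧ G.HasWalk u m v
    · obtain ⟨m, rfl, hm⟩ := hn
      obtain ⟨k, hk, hs⟩ := ih m (by omega) hm
      exact ⟨k, by rw [hk]; simp [parity_simps], hs⟩
    · push Not at hn
      exact ⟨n, Iff.rfl, h, hn⟩

theorem HasParityShortestWalk.exists_adj (h : G.HasParityShortestWalk u (n + 1) w) :
    ∃ v, G.Adj v w ∧ G.HasParityShortestWalk u n v := by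
  obtain ⟨v, hv, hvw⟩ := h.1.exists_adj
  exact ⟨v, hvw, hv, fun m hm hw ↦ h.2 (m + 1) (by omega) (hw.succ hvw)⟩

theorem HasParityShortestWalk.not_iff_of_adj (h : G.HasParityShortestWalk u (n + 1) v)
    (hvw : G.Adj v w) :
    ¬ G.HasParityShortestWalk u n w ↔ G.HasParityShortestWalk u (n + 2) w := by
  constructor
  · intro hn
    refine ⟨h.1.succ hvw, fun m hm hw ↦ hn ?_⟩
    obtain rfl : m = n := by omega
    exact ⟨hw, fun k hk hwk ↦ h.2 (k + 1) (by omega) (hwk.succ hvw.symm)⟩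
  · exact fun hs hn ↦ hs.2 n rfl hn.1

/-- Flooding sends a message along `(g, h)` in round `i + 1` exactly when `i` and `i + 1` are the
parity-shortest walk lengths from the initial node to `g` and `h`. -/
theorem flooding_mem_iff {g0 : V} {M : ℕ → Set (V × V)}
    (hM1 : M 1 = {p : V × V | p.1 = g0 ∧ G.Adj g0 p.2})
    (hMsucc : ∀ i ≥ 1, M (i + 1) =
      {p : V × V | G.Adj p.1 p.2 ∧ (∃ f, (f, p.1) ∈ M i) ∧ (p.2, p.1) ∉ M i})
    (i : ℕ) (g h : V) :
    (g, h) ∈ M (i + 1) ↔ G.Adj g h ∧ G.HasParityShortestWalk g0 i g ∧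
      G.HasParityShortestWalk g0 (i + 1) h := by
  induction i generalizing g h with
  | zero =>
    rw [zero_add, hM1]
    constructor
    · rintro ⟨rfl, hadj⟩
      have h0 : G.HasWalk g 0 g := hasWalk_zero.2 rfl
      exact ⟨hadj, ⟨h0, by omega⟩, h0.succ hadj, by omega⟩
    · rintro ⟨hadj, hg, -⟩
      obtain rfl := hasWalk_zero.1 hg.1
      exact ⟨rfl, hadj⟩
  | succ i ih =>
    rw [hMsucc (i + 1) (by omega)]
    simp only [Set.mem_ofPred_eq, ih]
    constructor
    · rintro ⟨hadj, ⟨f, -, -, hg⟩, hn⟩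
      exact ⟨hadj, hg, (hg.not_iff_of_adj hadj).1 fun hh ↦ hn ⟨hadj.symm, hh, hg⟩⟩
    · rintro ⟨hadj, hg, hh⟩
      obtain ⟨f, hfg, hf⟩ := hg.exists_adj
      exact ⟨hadj, ⟨f, hfg, hf, hg⟩, fun hn ↦ (hg.not_iff_of_adj hadj).2 hh hn.2.1⟩

end SimpleGraph

open SimpleGraph in
theorem stmt9 {V : Type*} [Fintype V] (G : SimpleGraph V)
    (hconn : G.Connected) (g0 : V)
    (M : ℕ → Set (V × V)) (R : ℕ → Set V)
    (hM1 : M 1 = {p : V × V | p.1 = g0 ∧ G.Adj g0 p.2})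
    (hMsucc : ∀ i ≥ 1, M (i + 1) =
      {p : V × V | G.Adj p.1 p.2 ∧ (∃ f, (f, p.1) ∈ M i) ∧ (p.2, p.1) ∉ M i})
    (hR0 : R 0 = {g0})
    (hRi : ∀ i ≥ 1, R i = {h : V | ∃ g, (g, h) ∈ M i})
    (e : ℕ) (he : IsGreatest {k : ℕ | ∃ g : V, G.dist g0 g = k} e) :
    (∀ i > e, R i = ∅) ↔ G.Colorable 2 := by
  have hM := flooding_mem_iff hM1 hMsucc
  constructor
  · intro hterm
    obtain ⟨⟨v, hv⟩, -⟩ := he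
    have hpar : ∀ n, G.HasWalk g0 n v → (Even n ↔ Even e) := by
      intro n hn
      obtain ⟨m, hmn, hm⟩ := hn.exists_hasParityShortestWalk
      obtain ⟨p, hp⟩ := hm.1
      have hle : e ≤ m := hv ▸ hp ▸ dist_le p
      rcases hle.eq_or_lt with rfl | hlt
      · exact hmn.symm
      · obtain ⟨k, rfl⟩ : ∃ k, m = k + 1 := ⟨m - 1, by omega⟩
        obtain ⟨f, hfv, hf⟩ := hm.exists_adj
        have hmem : v ∈ R (k + 1) := by
          rw [hRi _ (by omega)]
          exact ⟨f, (hM k f v).2 ⟨hfv, hf, hm⟩⟩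
        rw [hterm _ hlt] at hmem
        exact hmem.elim
    have hcol : G.Coloring Bool := Coloring.mk (fun x ↦ decide (Even (G.dist v x))) <| by
      intro x y hxy heq
      obtain ⟨p, hp⟩ := hconn.exists_walk_length_eq_dist g0 v
      obtain ⟨q, hq⟩ := hconn.exists_walk_length_eq_dist v x
      obtain ⟨r, hr⟩ := hconn.exists_walk_length_eq_dist v y
      have := hpar _ ⟨p.append ((q.concat hxy).append r.reverse), rfl⟩
      simp only [Walk.length_append, Walk.length_concat, Walk.length_reverse, hp, hq, hr, hv,
        decide_eq_decide, parity_simps] at this heq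
      tauto
    simpa using hcol.colorable
  · rintro ⟨c⟩ i hi
    rw [hRi i (by omega), Set.eq_empty_iff_forall_notMem]
    rintro h ⟨g, hg⟩
    obtain ⟨k, rfl⟩ : ∃ k, i = k + 1 := ⟨i - 1, by omega⟩
    obtain ⟨hadj, -, hh⟩ := (hM k g h).1 hg
    obtain ⟨p, hp⟩ := hh.1
    obtain ⟨q, hq⟩ := hconn.exists_walk_length_eq_dist g0 h
    have hle : G.dist g0 h ≤ e := he.2 ⟨h, rfl⟩
    let c' : G.Coloring Bool := G.recolorOfEquiv finTwoEquiv c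
    have hpq : Even p.length ↔ Even q.length := by
      rw [c'.even_length_iff_congr p, c'.even_length_iff_congr q]
    rw [hp, hq, Nat.even_iff, Nat.even_iff] at hpq
    have hq' : G.HasWalk g0 (G.dist g0 h) h := ⟨q, hq⟩
    refine hh.2 (k - 1) (by omega) ?_
    convert hq'.add_two_mul hadj.symm ((k - 1 - G.dist g0 h) / 2) using 1
    omega
end

section
/- Let G be a connected finite simple non-bipartite graph with diameter d, and let g0 ∈ G be an initial node with eccentricity e. Then every node h of G belongs to some round-set R_j for a second time with j ≤ e + d + 1. -/
namespace SimpleGraph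

/-- In a connected graph that is not 2-colorable, some edge joins two nodes at the same distance
from a given node. -/
theorem Connected.exists_adj_dist_eq {V : Type*} {G : SimpleGraph V} (hconn : G.Connected)
    (hnb : ¬ G.Colorable 2) (a : V) : ∃ u w, G.Adj u w ∧ G.dist a u = G.dist a w := by
  by_contra! hne
  refine hnb ⟨Coloring.mk (fun v => (⟨G.dist a v % 2, Nat.mod_lt _ two_pos⟩ : Fin 2)) ?_⟩
  intro v w hvw heq
  have hmod : G.dist a v % 2 = G.dist a w % 2 := congrArg Fin.val heq
  have hvw_ne := hne v w hvw
  have h1 := hconn.dist_triangle (u := a) (v := v) (w := w)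
  have h2 := hconn.dist_triangle (u := a) (v := w) (w := v)
  rw [dist_eq_one_iff_adj.mpr hvw] at h1
  rw [dist_eq_one_iff_adj.mpr hvw.symm] at h2
  omega

/-- A message sent in round `i + 1` is sent by a node reached by a walk of length `i`. -/
theorem exists_walk_of_mem_flooding {V : Type*} {G : SimpleGraph V} {g0 : V}
    {M : ℕ → Set (V × V)}
    (hM1 : M 1 = {p : V × V | p.1 = g0 ∧ G.Adj g0 p.2})
    (hMsucc : ∀ i ≥ 1, M (i + 1) =
      {p : V × V | G.Adj p.1 p.2 ∧ (∃ f, (f, p.1) ∈ M i) ∧ (p.2, p.1) ∉ M i})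
    {i : ℕ} {g h : V} (hgh : (g, h) ∈ M (i + 1)) :
    G.Adj g h ∧ ∃ p : G.Walk g0 g, p.length = i := by
  induction i generalizing g h with
  | zero =>
    rw [zero_add, hM1] at hgh
    obtain ⟨rfl, hadj⟩ := hgh
    exact ⟨hadj, .nil, rfl⟩
  | succ i ih =>
    rw [hMsucc (i + 1) (by omega)] at hgh
    obtain ⟨hadj, ⟨f, hf⟩, -⟩ := hgh
    obtain ⟨hfg, p, hp⟩ := ih hf
    exact ⟨hadj, p.concat hfg, by simp [hp]⟩

/-- A node is reached in round `n` when `n` is the least length of a walk of its parity from the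
initial node. -/
theorem mem_round_of_minimal {V : Type*} {G : SimpleGraph V} {g0 : V}
    {M : ℕ → Set (V × V)} {R : ℕ → Set V}
    (hM1 : M 1 = {p : V × V | p.1 = g0 ∧ G.Adj g0 p.2})
    (hMsucc : ∀ i ≥ 1, M (i + 1) =
      {p : V × V | G.Adj p.1 p.2 ∧ (∃ f, (f, p.1) ∈ M i) ∧ (p.2, p.1) ∉ M i})
    (hR0 : R 0 = {g0})
    (hRi : ∀ i ≥ 1, R i = {h : V | ∃ g, (g, h) ∈ M i})
    {n : ℕ} {h : V} (p : G.Walk g0 h) (hp : p.length = n)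
    (hmin : ∀ q : G.Walk g0 h, q.length % 2 = n % 2 → n ≤ q.length) : h ∈ R n := by
  induction n generalizing h with
  | zero =>
    rw [hR0]
    exact (Walk.eq_of_length_eq_zero hp).symm
  | succ n ih =>
    obtain ⟨g, q, hgh, rfl⟩ : ∃ (g : V) (q : G.Walk g0 g) (hgh : G.Adj g h),
        p = q.concat hgh := by
      cases p with
      | nil => simp at hp
      | cons hadj p =>
        obtain ⟨g, q, hgh, heq⟩ := Walk.exists_cons_eq_concat hadj p
        exact ⟨g, q, hgh, heq⟩
    have hq : q.length = n := by simpa using hp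
    have hg : g ∈ R n := ih q hq fun r hr => by
      have := hmin (r.concat hgh) (by rw [Walk.length_concat]; omega)
      rw [Walk.length_concat] at this
      omega
    rw [hRi (n + 1) (by omega)]
    refine ⟨g, ?_⟩
    cases n with
    | zero =>
      rw [hR0] at hg
      obtain rfl : g = g0 := hg
      rw [zero_add, hM1]
      exact ⟨rfl, hgh⟩
    | succ n =>
      rw [hRi (n + 1) (by omega)] at hg
      rw [hMsucc (n + 1) (by omega)]
      refine ⟨hgh, hg, fun hmem => ?_⟩
      obtain ⟨-, r, hr⟩ := exists_walk_of_mem_flooding hM1 hMsucc hmem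
      have := hmin r (by omega)
      omega

/-- A node joined to the initial node by a walk is reached in a round of the same parity as, and
no later than, the length of the walk. -/
theorem Walk.exists_mem_round {V : Type*} {G : SimpleGraph V} {g0 : V}
    {M : ℕ → Set (V × V)} {R : ℕ → Set V}
    (hM1 : M 1 = {p : V × V | p.1 = g0 ∧ G.Adj g0 p.2})
    (hMsucc : ∀ i ≥ 1, M (i + 1) =
      {p : V × V | G.Adj p.1 p.2 ∧ (∃ f, (f, p.1) ∈ M i) ∧ (p.2, p.1) ∉ M i})
    (hR0 : R 0 = {g0})
    (hRi : ∀ i ≥ 1, R i = {h : V | ∃ g, (g, h) ∈ M i})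
    {h : V} (p : G.Walk g0 h) : ∃ n ≤ p.length, n % 2 = p.length % 2 ∧ h ∈ R n := by
  classical
  have hex : ∃ n, ∃ q : G.Walk g0 h, q.length = n ∧ n % 2 = p.length % 2 := ⟨_, p, rfl, rfl⟩
  obtain ⟨q, hq, hpar⟩ := Nat.find_spec hex
  exact ⟨Nat.find hex, Nat.find_min' hex ⟨p, rfl, rfl⟩, hpar,
    mem_round_of_minimal hM1 hMsucc hR0 hRi q hq fun r hr =>
      Nat.find_min' hex ⟨r, rfl, hr.trans hpar⟩⟩

end SimpleGraph

theorem stmt11 {V : Type*} [Fintype V] (G : SimpleGraph V)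
    (hconn : G.Connected) (g0 : V)
    (M : ℕ → Set (V × V)) (R : ℕ → Set V)
    (hM1 : M 1 = {p : V × V | p.1 = g0 ∧ G.Adj g0 p.2})
    (hMsucc : ∀ i ≥ 1, M (i + 1) =
      {p : V × V | G.Adj p.1 p.2 ∧ (∃ f, (f, p.1) ∈ M i) ∧ (p.2, p.1) ∉ M i})
    (hR0 : R 0 = {g0})
    (hRi : ∀ i ≥ 1, R i = {h : V | ∃ g, (g, h) ∈ M i})
    (hnb : ¬ G.Colorable 2)
    (e : ℕ) (he : IsGreatest {k : ℕ | ∃ g : V, G.dist g0 g = k} e)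
    (d : ℕ) (hd : IsGreatest {k : ℕ | ∃ u v : V, G.dist u v = k} d) :
    ∀ h : V, ∃ j ≤ e + d + 1, h ∈ R j ∧ ∃ i < j, h ∈ R i := by
  intro h
  obtain ⟨u, w, huw, hdist⟩ := hconn.exists_adj_dist_eq hnb g0
  obtain ⟨p, hp⟩ := hconn.exists_walk_length_eq_dist g0 u
  obtain ⟨q, hq⟩ := hconn.exists_walk_length_eq_dist g0 w
  obtain ⟨r, hr⟩ := hconn.exists_walk_length_eq_dist u h
  have hu : G.dist g0 u ≤ e := he.2 ⟨u, rfl⟩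
  have huh : G.dist u h ≤ d := hd.2 ⟨u, h, rfl⟩
  obtain ⟨a, ha, ha_par, haR⟩ := (p.append r).exists_mem_round hM1 hMsucc hR0 hRi
  obtain ⟨b, hb, hb_par, hbR⟩ :=
    ((q.concat huw.symm).append r).exists_mem_round hM1 hMsucc hR0 hRi
  simp only [SimpleGraph.Walk.length_append, SimpleGraph.Walk.length_concat] at ha ha_par hb hb_par
  rcases lt_or_gt_of_ne (show a ≠ b by omega) with hab | hab
  · exact ⟨b, by omega, hbR, a, hab, haR⟩
  · exact ⟨a, by omega, haR, b, hab, hbR⟩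
end
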